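/- Let Q : [0, T⁺) → M_N(ℂ) be the maximal solution of Q' + Q² + V''(x_c(t)) = 0, Q(0) = i b I_N, and write Q₁ := Re Q, Q₂ := Im Q. If t ∈ [0, T⁺) is such that ‖Q₁(s)‖ ≤ 1 for all s ∈ [0, t], then ‖Q₂(t) − b I_N‖ ≤ 2 t b e^{2t}, where ‖·‖ is the matrix operator norm. In particular, if moreover 2 t e^{2t} ≤ 1/2, then (b/2) I_N ≤ Q₂(t) ≤ (3b/2) I_N in the Loewner order. -/

import Mathlib

open MeasureTheory Matrix Real Set Filter
open scoped InnerProductSpace ENNReal Topology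

noncomputable section

attribute [local instance] Matrix.normedAddCommGroup Matrix.normedSpace

/-- `ℝ^N` as a Euclidean space. -/
abbrev EucSp (N : ℕ) := EuclideanSpace ℝ (Fin N)

/-- A potential `V : ℝ^N → ℝ` is subquadratic if it is `C^∞` and all its derivatives of
order `≥ 2` are (globally) bounded. -/
def Subquadratic {N : ℕ} (V : EucSp N → ℝ) : Prop :=
  ContDiff ℝ (⊤ : ℕ∞) V ∧ ∀ n : ℕ, 2 ≤ n → ∃ C : ℝ, ∀ x, ‖iteratedFDeriv ℝ n V x‖ ≤ C

/-- `E : ℝ → ℝ^N` is piecewise continuous: on each compact interval it has finitely many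
discontinuities and is bounded. -/
def PiecewiseContinuous {N : ℕ} (E : ℝ → EucSp N) : Prop :=
  ∀ a b : ℝ, ∃ s : Finset ℝ,
    (∀ t ∈ Set.Icc a b, t ∉ s → ContinuousAt E t) ∧ ∃ C : ℝ, ∀ t ∈ Set.Icc a b, ‖E t‖ ≤ C

/-- The Hessian matrix `V''(x)` of `V` at `x`. -/
def hessMat {N : ℕ} (V : EucSp N → ℝ) (x : EucSp N) : Matrix (Fin N) (Fin N) ℝ :=
  Matrix.of fun i j =>
    iteratedFDeriv ℝ 2 V x ![EuclideanSpace.single i 1, EuclideanSpace.single j 1]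

/-- The operator norm of a matrix, induced by the Euclidean norm. -/
def opNorm {N : ℕ} {𝕜 : Type} [RCLike 𝕜] (M : Matrix (Fin N) (Fin N) 𝕜) : ℝ :=
  ‖LinearMap.toContinuousLinearMap (Matrix.toEuclideanLin M)‖

/-- Real part of a complex matrix. -/
def RePart {N : ℕ} (M : Matrix (Fin N) (Fin N) ℂ) : Matrix (Fin N) (Fin N) ℝ :=
  M.map Complex.re

/-- Imaginary part of a complex matrix. -/
def ImPart {N : ℕ} (M : Matrix (Fin N) (Fin N) ℂ) : Matrix (Fin N) (Fin N) ℝ :=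
  M.map Complex.im

/-- The normalization constant `C_N = (∫_{ℝ^N} e^{-‖y‖²} dy)^{1/2}`. -/
def CN (N : ℕ) : ℝ := Real.sqrt (∫ y : EucSp N, Real.exp (-‖y‖ ^ 2))

/-- The constant `C_* = (1/(6 C_N)) (∫_{ℝ^N} ‖y‖⁶ e^{-‖y‖²} dy)^{1/2}`. -/
def Cstar (N : ℕ) : ℝ :=
  (1 / (6 * CN N)) * Real.sqrt (∫ y : EucSp N, ‖y‖ ^ 6 * Real.exp (-‖y‖ ^ 2))

/-- `(x_c, v)` is a (global, `C¹`) solution of the controlled Newton equation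
`x_c'' + ∇V(x_c) = E`, `x_c(0) = x₀`, `x_c'(0) = v₀`; the second-order ODE holds at every
point where `E` is continuous. -/
def IsNewtonSol {N : ℕ} (V : EucSp N → ℝ) (E : ℝ → EucSp N) (x₀ v₀ : EucSp N)
    (x_c v : ℝ → EucSp N) : Prop :=
  x_c 0 = x₀ ∧ v 0 = v₀ ∧ Continuous v ∧ (∀ t, HasDerivAt x_c (v t) t) ∧
    ∀ t, ContinuousAt E t → HasDerivAt v (E t - gradient V (x_c t)) t

/-- Right-hand side of the Riccati equation `Q' = -(Q² + V''(x_c t))`. -/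
def riccatiF {N : ℕ} (V : EucSp N → ℝ) (x_c : ℝ → EucSp N)
    (Q : ℝ → Matrix (Fin N) (Fin N) ℂ) (t : ℝ) : Matrix (Fin N) (Fin N) ℂ :=
  -(Q t ^ 2 + (hessMat V (x_c t)).map (fun a : ℝ => (a : ℂ)))

/-- The initial datum `i b I_N`. -/
def riccatiInit (N : ℕ) (b : ℝ) : Matrix (Fin N) (Fin N) ℂ :=
  ((b : ℂ) * Complex.I) • (1 : Matrix (Fin N) (Fin N) ℂ)

/-- The bilinear form `⟨M y, y⟩ = ∑ᵢⱼ Mᵢⱼ yⱼ yᵢ` on `ℂ^N`, for a real vector `y`. -/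
def qFormC {N : ℕ} (M : Matrix (Fin N) (Fin N) ℂ) (y : EucSp N) : ℂ :=
  ∑ i, ∑ j, M i j * (y j : ℂ) * (y i : ℂ)

/-- The quadratic form `⟨M y, y⟩ = ∑ᵢⱼ Mᵢⱼ yⱼ yᵢ` on `ℝ^N`. -/
def qFormR {N : ℕ} (M : Matrix (Fin N) (Fin N) ℝ) (y : EucSp N) : ℝ :=
  ∑ i, ∑ j, M i j * y j * y i

/-- The classical action
`S(t,x) = ∫₀ᵗ (½‖x_c'(s)‖² - V(x_c(s))) ds + ⟨x_c'(t), x - x_c(t)⟩`. -/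
def action {N : ℕ} (V : EucSp N → ℝ) (x_c v : ℝ → EucSp N) (t : ℝ) (x : EucSp N) : ℝ :=
  (∫ s in (0:ℝ)..t, ((1:ℝ)/2 * ‖v s‖ ^ 2 - V (x_c s))) + ⟪v t, x - x_c t⟫_ℝ

/-- The trajectory-coherent state `ψ̃(t,x)`. -/
def psiTilde {N : ℕ} (V : EucSp N → ℝ) (E : ℝ → EucSp N) (b : ℝ)
    (x_c v : ℝ → EucSp N) (Q : ℝ → Matrix (Fin N) (Fin N) ℂ) (t : ℝ) (x : EucSp N) : ℂ :=
  ((b ^ ((N : ℝ) / 4) / CN N : ℝ) : ℂ) *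
    Complex.exp (Complex.I * (((action V x_c v t x : ℝ) : ℂ)
        + (1/2 : ℂ) * qFormC (Q t) (x - x_c t))
      + ∫ s in (0:ℝ)..t, (Complex.I * ((⟪x_c s, E s⟫_ℝ : ℝ) : ℂ) - (Q s).trace / 2))

/-- The third-order Taylor remainder of `V` at `x_c(t)`:
`V(x) - V(x_c) - ⟨∇V(x_c), x - x_c⟩ - ½⟨V''(x_c)(x - x_c), x - x_c⟩`. -/
def taylorRem3 {N : ℕ} (V : EucSp N → ℝ) (x_c : ℝ → EucSp N) (t : ℝ) (x : EucSp N) : ℝ :=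
  V x - V (x_c t) - ⟪gradient V (x_c t), x - x_c t⟫_ℝ
    - (1/2) * qFormR (hessMat V (x_c t)) (x - x_c t)

/-- The source term `r(t,x)` (Taylor remainder of `V` at `x_c(t)` multiplied by `-ψ̃`). -/
def rRem {N : ℕ} (V : EucSp N → ℝ) (E : ℝ → EucSp N) (b : ℝ)
    (x_c v : ℝ → EucSp N) (Q : ℝ → Matrix (Fin N) (Fin N) ℂ) (t : ℝ) (x : EucSp N) : ℂ :=
  -((taylorRem3 V x_c t x : ℝ) : ℂ) * psiTilde V E b x_c v Q t x

/-- Membership in the class `𝒱` of unit-norm states whose modulus is a Gaussian with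
covariance parameter `q` between `√(b/2) I_N` and `√(3b/2) I_N`. -/
def InGaussClass (N : ℕ) (b : ℝ) (φ : EucSp N → ℂ) : Prop :=
  eLpNorm φ 2 volume = 1 ∧
    ∃ (q : Matrix (Fin N) (Fin N) ℝ) (α : EucSp N), q.PosSemidef ∧
      (q - Real.sqrt (b/2) • 1).PosSemidef ∧ (Real.sqrt (3*b/2) • 1 - q).PosSemidef ∧
      ∀ᵐ x : EucSp N, ‖φ x‖ ^ 2 =
        q.det / (CN N) ^ 2 * Real.exp (-∑ i, (q.mulVec (fun j => x j - α j) i) ^ 2)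

/-- The set `𝒱` inside `L²(ℝ^N, ℂ)`. -/
def GaussSet (N : ℕ) (b : ℝ) : Set (Lp ℂ 2 (volume : Measure (EucSp N))) :=
  {φ | InGaussClass N b ⇑φ}

end

attribute [local instance] Matrix.normedAddCommGroup Matrix.normedSpace

/-- Post-composition of a within-derivative with a real-linear map on complex matrices. -/
theorem aux_deriv {N : ℕ} {E : Type} [NormedAddCommGroup E] [NormedSpace ℝ E]
    (L : Matrix (Fin N) (Fin N) ℂ →ₗ[ℝ] E) {Q : ℝ → Matrix (Fin N) (Fin N) ℂ}
    {Q' : Matrix (Fin N) (Fin N) ℂ} {s : Set ℝ} {t : ℝ} (h : HasDerivWithinAt Q Q' s t) :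
    HasDerivWithinAt (fun u => L (Q u)) (L Q') s t := by
  have := (LinearMap.toContinuousLinearMap L).hasFDerivAt.comp_hasDerivWithinAt t h
  exact this

/-- Real-linear map `M ↦ Im M` into operators. -/
noncomputable def auxIm (N : ℕ) : Matrix (Fin N) (Fin N) ℂ →ₗ[ℝ]
    (EuclideanSpace ℝ (Fin N) →L[ℝ] EuclideanSpace ℝ (Fin N)) where
  toFun M := Matrix.toEuclideanCLM (n := Fin N) (𝕜 := ℝ) (ImPart M)
  map_add' A B := by
    rw [← map_add]; congr 1
  map_smul' c A := by
    rw [← map_smul]; congr 1; ext i j; simp [ImPart]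

/-- Real-linear map `M ↦ M` into operators. -/
noncomputable def auxC (N : ℕ) : Matrix (Fin N) (Fin N) ℂ →ₗ[ℝ]
    (EuclideanSpace ℂ (Fin N) →L[ℂ] EuclideanSpace ℂ (Fin N)) where
  toFun M := Matrix.toEuclideanCLM (n := Fin N) (𝕜 := ℂ) M
  map_add' A B := by
    rw [← map_add]
  map_smul' c A := by
    have : c • A = (c : ℂ) • A := by ext i j; simp
    rw [this, map_smul]; ext x; simp

/-- Real-linear map `M ↦ Mᵀ` . -/
noncomputable def auxT (N : ℕ) : Matrix (Fin N) (Fin N) ℂ →ₗ[ℝ] Matrix (Fin N) (Fin N) ℂ where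
  toFun M := Mᵀ
  map_add' A B := rfl
  map_smul' c A := rfl

theorem auxT_apply {N : ℕ} (M : Matrix (Fin N) (Fin N) ℂ) : auxT N M = Mᵀ := rfl

theorem opNorm_eq_aux {N : ℕ} (M : Matrix (Fin N) (Fin N) ℝ) :
    opNorm M = ‖Matrix.toEuclideanCLM (n := Fin N) (𝕜 := ℝ) M‖ := rfl

theorem hess_symm_aux {N : ℕ} {V : EucSp N → ℝ} (hV : Subquadratic V) (x : EucSp N) :
    (hessMat V x)ᵀ = hessMat V x := by
  have h : IsSymmSndFDerivAt ℝ V x :=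
    (hV.1.contDiffAt).isSymmSndFDerivAt (by simp; exact WithTop.coe_le_coe.2 (le_top (a := (2 : ℕ∞))))
  ext i j
  simp only [hessMat, Matrix.transpose_apply, Matrix.of_apply, iteratedFDeriv_two_apply]
  exact h _ _

theorem auxC_mul {N : ℕ} (A B : Matrix (Fin N) (Fin N) ℂ) :
    auxC N (A * B) = auxC N A * auxC N B :=
  map_mul (Matrix.toEuclideanCLM (n := Fin N) (𝕜 := ℂ)) A B

theorem symm_aux {N : ℕ} {V : EucSp N → ℝ} (hV : Subquadratic V)
    {x_c : ℝ → EucSp N} {b : ℝ} {Tplus : ℝ} {Q : ℝ → Matrix (Fin N) (Fin N) ℂ}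
    (hQ0 : Q 0 = riccatiInit N b)
    (hQ : ∀ t ∈ Set.Ico 0 Tplus, HasDerivWithinAt Q (riccatiF V x_c Q t) (Set.Ici 0) t)
    {t : ℝ} (ht : t ∈ Set.Ico 0 Tplus) : (Q t)ᵀ = Q t := by
  have hsub : ∀ s ∈ Set.Icc 0 t, s ∈ Set.Ico 0 Tplus := fun s hs => ⟨hs.1, hs.2.trans_lt ht.2⟩
  have hc : ∀ {E : Type} [NormedAddCommGroup E] [NormedSpace ℝ E]
      (L : Matrix (Fin N) (Fin N) ℂ →ₗ[ℝ] E), ContinuousOn (fun u => L (Q u)) (Set.Icc 0 t) := by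
    intro E _ _ L s hs
    exact ((aux_deriv L (hQ s (hsub s hs))).continuousWithinAt).mono Set.Icc_subset_Ici_self
  obtain ⟨K1, hK1⟩ := isCompact_Icc.exists_bound_of_continuousOn (hc (auxC N))
  obtain ⟨K2, hK2⟩ := isCompact_Icc.exists_bound_of_continuousOn (hc (auxC N ∘ₗ auxT N))
  have key := eq_zero_of_abs_deriv_le_mul_abs_self_of_eq_zero_right
    (f := fun u => (auxC N - auxC N ∘ₗ auxT N) (Q u))
    (f' := fun u => (auxC N - auxC N ∘ₗ auxT N) (riccatiF V x_c Q u)) (K := K1 + K2)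
    (a := 0) (b := t) (hc _)
    (fun s hs => (aux_deriv _ (hQ s (hsub s ⟨hs.1, hs.2.le⟩))).mono (Set.Ici_subset_Ici.2 hs.1))
    (by
      simp only [hQ0, LinearMap.sub_apply, LinearMap.comp_apply, sub_eq_zero]
      congr 1
      simp [riccatiInit, auxT_apply]) ?_ t ⟨ht.1, le_rfl⟩
  · simp only [LinearMap.sub_apply, LinearMap.comp_apply, sub_eq_zero] at key
    exact ((Matrix.toEuclideanCLM (n := Fin N) (𝕜 := ℂ)).injective key).symm
  · intro s hs
    have hs' : s ∈ Set.Icc 0 t := ⟨hs.1, hs.2.le⟩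
    have e : (auxC N - auxC N ∘ₗ auxT N) (riccatiF V x_c Q s) =
        -(auxC N (Q s) * (auxC N - auxC N ∘ₗ auxT N) (Q s) +
          (auxC N - auxC N ∘ₗ auxT N) (Q s) * (auxC N ∘ₗ auxT N) (Q s)) := by
      simp only [LinearMap.sub_apply, LinearMap.comp_apply]
      rw [← map_sub, ← map_sub, ← auxC_mul, ← auxC_mul, ← map_add, ← map_neg]
      congr 1
      have h := hess_symm_aux hV (x_c s)
      have : auxT N (riccatiF V x_c Q s) =
          -((Q s)ᵀ ^ 2 + (hessMat V (x_c s)).map (fun a : ℝ => (a : ℂ))) := by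
        simp only [auxT_apply, riccatiF, Matrix.transpose_neg,
          Matrix.transpose_add, Matrix.transpose_pow, ← Matrix.transpose_map, h]
      rw [this]
      simp only [riccatiF, auxT_apply]
      noncomm_ring
    rw [e, norm_neg]
    have a1 := hK1 s hs'
    have a2 := hK2 s hs'
    have n0 := norm_nonneg ((auxC N - auxC N ∘ₗ auxT N) (Q s))
    refine (norm_add_le _ _).trans ?_
    have b1 := norm_mul_le (auxC N (Q s)) ((auxC N - auxC N ∘ₗ auxT N) (Q s))
    have b2 := norm_mul_le ((auxC N - auxC N ∘ₗ auxT N) (Q s)) ((auxC N ∘ₗ auxT N) (Q s))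
    have c1 := mul_le_mul_of_nonneg_right a1 n0
    have c2 := mul_le_mul_of_nonneg_left a2 n0
    linarith

theorem im_riccati_aux {N : ℕ} (V : EucSp N → ℝ) (x_c : ℝ → EucSp N)
    (Q : ℝ → Matrix (Fin N) (Fin N) ℂ) (s : ℝ) :
    ImPart (riccatiF V x_c Q s) =
      -(RePart (Q s) * ImPart (Q s) + ImPart (Q s) * RePart (Q s)) := by
  ext i j
  simp only [ImPart, RePart, riccatiF, pow_two, Matrix.map_apply, Matrix.neg_apply,
    Matrix.add_apply, Matrix.mul_apply, Complex.neg_im, Complex.add_im, Complex.im_sum,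
    Complex.mul_im, Complex.ofReal_im, add_zero, Finset.sum_add_distrib]

theorem psd_aux {N : ℕ} (R : Matrix (Fin N) (Fin N) ℝ) (hR : Rᵀ = R) (c : ℝ)
    (h : opNorm R ≤ c) : (R + c • 1).PosSemidef := by
  refine Matrix.PosSemidef.of_dotProduct_mulVec_nonneg ?_ ?_
  · simp [Matrix.IsHermitian, Matrix.conjTranspose_eq_transpose_of_trivial, hR]
  · intro x
    have h1 := Matrix.inner_toEuclideanCLM R (WithLp.toLp 2 x) (WithLp.toLp 2 x)
    have h2 := abs_real_inner_le_norm (WithLp.toLp 2 x)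
      (Matrix.toEuclideanCLM (𝕜 := ℝ) R (WithLp.toLp 2 x))
    have h3 := (Matrix.toEuclideanCLM (n := Fin N) (𝕜 := ℝ) R).le_opNorm (WithLp.toLp 2 x)
    rw [← opNorm_eq_aux] at h3
    have h4 : ‖WithLp.toLp 2 x‖ * ‖WithLp.toLp 2 x‖ = x ⬝ᵥ x := by
      rw [← real_inner_self_eq_norm_mul_norm, EuclideanSpace.inner_eq_star_dotProduct]; simp
    have n0 := norm_nonneg (WithLp.toLp 2 x)
    have h5 := mul_le_mul_of_nonneg_left h3 n0
    have h6 := mul_le_mul_of_nonneg_right h (mul_nonneg n0 n0)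
    rw [h1] at h2
    have h7 := (abs_le.1 h2).1
    simp only [star_trivial, Matrix.add_mulVec, Matrix.smul_mulVec, Matrix.one_mulVec,
      dotProduct_add, dotProduct_smul, smul_eq_mul]
    simp only at h7
    rw [← h4]
    nlinarith

/-- If `‖Q₁(s)‖ ≤ 1` on `[0, t]`, then `‖Q₂(t) - b I_N‖ ≤ 2 t b e^{2t}`;
if moreover `2 t e^{2t} ≤ 1/2`, then `(b/2) I_N ≤ Q₂(t) ≤ (3b/2) I_N` in the Loewner order. -/
theorem statement5 {N : ℕ} (hN : 1 ≤ N) (V : EucSp N → ℝ) (hV : Subquadratic V)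
    (x_c : ℝ → EucSp N) (hxc : Continuous x_c) (b : ℝ) (hb : 0 < b)
    (Tplus : ℝ) (Q : ℝ → Matrix (Fin N) (Fin N) ℂ)
    (hQ0 : Q 0 = riccatiInit N b)
    (hQ : ∀ t ∈ Set.Ico 0 Tplus, HasDerivWithinAt Q (riccatiF V x_c Q t) (Set.Ici 0) t)
    (t : ℝ) (ht : t ∈ Set.Ico 0 Tplus)
    (h1 : ∀ s ∈ Set.Icc 0 t, opNorm (RePart (Q s)) ≤ 1) :
    opNorm (ImPart (Q t) - b • 1) ≤ 2 * t * b * Real.exp (2 * t) ∧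
    (2 * t * Real.exp (2 * t) ≤ 1/2 →
      (ImPart (Q t) - (b/2) • 1).PosSemidef ∧
      ((3*b/2) • 1 - ImPart (Q t)).PosSemidef) := by
  have hsub : ∀ s ∈ Set.Icc 0 t, s ∈ Set.Ico 0 Tplus := fun s hs => ⟨hs.1, hs.2.trans_lt ht.2⟩
  have hone : auxIm N (riccatiInit N b) = b • 1 := by
    have : ImPart (riccatiInit N b) = b • 1 := by
      ext i j
      by_cases hij : i = j <;> simp [ImPart, riccatiInit, hij]
    change Matrix.toEuclideanCLM (n := Fin N) (𝕜 := ℝ) (ImPart (riccatiInit N b)) = _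
    rw [this, map_smul, map_one]
  have hsubn : ∀ s, opNorm (ImPart (Q s) - b • 1) = ‖auxIm N (Q s) - b • 1‖ := by
    intro s
    rw [opNorm_eq_aux, map_sub, map_smul, map_one]; rfl
  have key := norm_le_gronwallBound_of_norm_deriv_right_le
    (f := fun u => auxIm N (Q u) - b • 1) (f' := fun u => auxIm N (riccatiF V x_c Q u))
    (δ := 0) (K := 2) (ε := 2 * b) (a := 0) (b := t)
    (fun s hs => (((aux_deriv _ (hQ s (hsub s hs))).sub_const _).continuousWithinAt).mono
      Set.Icc_subset_Ici_self)
    (fun s hs => ((aux_deriv _ (hQ s (hsub s ⟨hs.1, hs.2.le⟩))).sub_const _).mono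
      (Set.Ici_subset_Ici.2 hs.1))
    (by simp [hQ0, hone]) ?_ t ⟨ht.1, le_rfl⟩
  swap
  · intro s hs
    have a1 := h1 s ⟨hs.1, hs.2.le⟩
    rw [opNorm_eq_aux] at a1
    have e : auxIm N (riccatiF V x_c Q s) =
        -(Matrix.toEuclideanCLM (n := Fin N) (𝕜 := ℝ) (RePart (Q s)) * auxIm N (Q s) +
          auxIm N (Q s) * Matrix.toEuclideanCLM (n := Fin N) (𝕜 := ℝ) (RePart (Q s))) := by
      change Matrix.toEuclideanCLM (n := Fin N) (𝕜 := ℝ) (ImPart (riccatiF V x_c Q s)) = _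
      rw [im_riccati_aux, map_neg, map_add, map_mul, map_mul]; rfl
    have n0 := norm_nonneg (auxIm N (Q s))
    have b1 := norm_mul_le (Matrix.toEuclideanCLM (n := Fin N) (𝕜 := ℝ) (RePart (Q s)))
      (auxIm N (Q s))
    have b2 := norm_mul_le (auxIm N (Q s))
      (Matrix.toEuclideanCLM (n := Fin N) (𝕜 := ℝ) (RePart (Q s)))
    have c1 := mul_le_mul_of_nonneg_right a1 n0
    have c2 := mul_le_mul_of_nonneg_left a1 n0
    have d := norm_add_le (Matrix.toEuclideanCLM (n := Fin N) (𝕜 := ℝ) (RePart (Q s)) *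
      auxIm N (Q s))
      (auxIm N (Q s) * Matrix.toEuclideanCLM (n := Fin N) (𝕜 := ℝ) (RePart (Q s)))
    have g := norm_add_le (auxIm N (Q s) - b • 1) (b • 1)
    rw [sub_add_cancel] at g
    have g2 : ‖b • (1 : EuclideanSpace ℝ (Fin N) →L[ℝ] EuclideanSpace ℝ (Fin N))‖ ≤ b := by
      rw [norm_smul, Real.norm_eq_abs, abs_of_pos hb]
      have : ‖(1 : EuclideanSpace ℝ (Fin N) →L[ℝ] EuclideanSpace ℝ (Fin N))‖ ≤ 1 :=
        ContinuousLinearMap.norm_id_le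
      nlinarith
    rw [e, norm_neg]
    linarith
  have main : opNorm (ImPart (Q t) - b • 1) ≤ 2 * t * b * Real.exp (2 * t) := by
    rw [hsubn]
    refine key.trans ?_
    rw [gronwallBound_of_K_ne_0 two_ne_zero]
    simp only [sub_zero, zero_mul, zero_add]
    have h3 := Real.add_one_le_exp (-(2 * t))
    have h4 : Real.exp (-(2 * t)) * Real.exp (2 * t) = 1 := by
      rw [← Real.exp_add]; simp
    have h5 := mul_le_mul_of_nonneg_right h3 (Real.exp_pos (2 * t)).le
    have h6 : Real.exp (2 * t) - 1 ≤ 2 * t * Real.exp (2 * t) := by nlinarith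
    have h7 := mul_le_mul_of_nonneg_left h6 hb.le
    linarith
  refine ⟨main, fun hsmall => ?_⟩
  have hsy := symm_aux hV hQ0 hQ ht
  have hR : (ImPart (Q t) - b • 1)ᵀ = ImPart (Q t) - b • 1 := by
    simp only [Matrix.transpose_sub, Matrix.transpose_smul, Matrix.transpose_one, ImPart,
      ← Matrix.transpose_map, hsy]
  have hle : opNorm (ImPart (Q t) - b • 1) ≤ b / 2 := by
    have := mul_le_mul_of_nonneg_left hsmall hb.le
    linarith
  have p1 := psd_aux _ hR _ hle
  have p2 := psd_aux (-(ImPart (Q t) - b • 1)) (by rw [Matrix.transpose_neg, hR]) (b / 2)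
    (by rw [opNorm_eq_aux, map_neg, norm_neg]; exact hle)
  constructor
  · convert p1 using 1
    module
  · convert p2 using 1
    module
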